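/- Let $X_k = A X_{k-1} + V_k$ be a two-state hidden Markov chain with transition matrix $A$, observations $y_k$ with output likelihood matrix $B(y_k) = \mathrm{diag}(f^1(y_k), f^2(y_k))$, and let $\mathcal{O}_k^i = \sum_{n=0}^{k-1}\langle X_n, e_i\rangle$ be the occupation time of state $e_i$ up to time $k$. Then the conditional mean estimates $\hat{\mathcal{O}}_k^{i,X} = \mathbb{E}[\mathcal{O}_k^i X_k \mid y_{[1,k]}]$ satisfy the recursion $\hat{\mathcal{O}}_k^{i,X} = N_k B(y_k) A (\hat{\mathcal{O}}_{k-1}^{i,X} + \hat{X}_{k-1}^i e_i)$, where $N_k^{-1} = \langle \underline{1}, B(y_k) A \hat{X}_{k-1}\rangle$ and $\hat{X}_k$ is the HMM filter state. -/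

import Mathlib

open MeasureTheory Matrix

lemma occ_map_eq {Ω E : Type*} [MeasurableSpace Ω] [MeasurableSpace E]
    (μ : Measure Ω) [IsProbabilityMeasure μ] (W : Ω → E) (y : Ω → ℝ)
    (hW : Measurable W) (hy : Measurable y) (K : Ω → ℝ)
    (b : E → ℝ) (hbm : Measurable b) (g : ℝ → ℝ) (hg : Measurable g)
    (h1 : ∀ D T, MeasurableSet D → MeasurableSet T →
      ∫⁻ ω in W ⁻¹' D ∩ y ⁻¹' T, ENNReal.ofReal (K ω) ∂μ =
        (∫⁻ e in D, ENNReal.ofReal (b e) ∂(μ.map W)) * ∫⁻ s in T, ENNReal.ofReal (g s)) :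
    (μ.withDensity (fun ω => ENNReal.ofReal (K ω))).map (fun ω => (W ω, y ω)) =
      ((μ.map W).prod volume).withDensity
        (fun z => ENNReal.ofReal (b z.1) * ENNReal.ofReal (g z.2)) := by
  have : IsProbabilityMeasure (μ.map W) := Measure.isProbabilityMeasure_map hW.aemeasurable
  rw [← prod_withDensity (f := fun e => ENNReal.ofReal (b e)) (g := fun s => ENNReal.ofReal (g s))
    hbm.ennreal_ofReal hg.ennreal_ofReal]
  symm
  apply Measure.prod_eq
  intro D T hD hT
  rw [Measure.map_apply (hW.prodMk hy) (hD.prod hT), withDensity_apply _ hD, withDensity_apply _ hT,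
    withDensity_apply _ ((hW.prodMk hy) (hD.prod hT)), ← h1 D T hD hT]
  rfl

lemma occ_bayes {Ω E : Type*} [mΩ : MeasurableSpace Ω] [mE : MeasurableSpace E]
    (μ : Measure Ω) [IsProbabilityMeasure μ] (W : Ω → E) (y : Ω → ℝ)
    (hW : Measurable W) (hy : Measurable y) (K : Ω → ℝ) (hK : Integrable K μ) (hK0 : ∀ ω, 0 ≤ K ω)
    (S : Fin 2 → Ω → ℝ) (hS : ∀ i, Measurable (S i)) (hS0 : ∀ i ω, 0 ≤ S i ω)
    (hS1 : ∀ ω, S 0 ω + S 1 ω = 1)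
    (g : Fin 2 → ℝ → ℝ) (hg : ∀ i, Measurable (g i)) (hg0 : ∀ i s, 0 < g i s)
    (a : Fin 2 → E → ℝ) (ham : ∀ i, Measurable (a i)) (ha0 : ∀ i, ∀ᵐ e ∂(μ.map W), 0 ≤ a i e)
    (ha1 : ∀ᵐ e ∂(μ.map W), a 0 e + a 1 e = 1)
    (b : E → ℝ) (hbm : Measurable b) (hb0 : ∀ᵐ e ∂(μ.map W), 0 ≤ b e) (j : Fin 2)
    (h1 : ∀ D T, MeasurableSet D → MeasurableSet T →
      ∫⁻ ω in W ⁻¹' D ∩ y ⁻¹' T, ENNReal.ofReal (K ω) ∂μ =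
        (∫⁻ e in D, ENNReal.ofReal (b e) ∂(μ.map W)) * ∫⁻ s in T, ENNReal.ofReal (g j s))
    (h2 : ∀ i D T, MeasurableSet D → MeasurableSet T →
      ∫⁻ ω in W ⁻¹' D ∩ y ⁻¹' T, ENNReal.ofReal (S i ω) ∂μ =
        (∫⁻ e in D, ENNReal.ofReal (a i e) ∂(μ.map W)) * ∫⁻ s in T, ENNReal.ofReal (g i s)) :
    μ[K | MeasurableSpace.comap (fun ω => (W ω, y ω)) inferInstance] =ᵐ[μ]
      fun ω => (g 0 (y ω) * a 0 (W ω) + g 1 (y ω) * a 1 (W ω))⁻¹ * (g j (y ω) * b (W ω)) := by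
  have : IsProbabilityMeasure (μ.map W) := Measure.isProbabilityMeasure_map hW.aemeasurable
  have hP : Measurable (fun ω => (W ω, y ω)) := hW.prodMk hy
  have hM1 := occ_map_eq μ W y hW hy K b hbm (g j) (hg j) h1
  have hM2 := fun i => occ_map_eq μ W y hW hy (S i) (a i) (ham i) (g i) (hg i) (h2 i)
  set P := fun ω => (W ω, y ω) with hPdef
  set κ := (μ.map W).prod (volume : Measure ℝ) with hκ
  -- law of the pair
  have hlaw : μ.map P = κ.withDensity (fun z =>
      ENNReal.ofReal (a 0 z.1) * ENNReal.ofReal (g 0 z.2) +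
      ENNReal.ofReal (a 1 z.1) * ENNReal.ofReal (g 1 z.2)) := by
    have hm : Measurable (fun z : E × ℝ => ENNReal.ofReal (a 0 z.1) * ENNReal.ofReal (g 0 z.2)) := by
      have := ham 0; have := hg 0; fun_prop
    have e1 : κ.withDensity (fun z =>
      ENNReal.ofReal (a 0 z.1) * ENNReal.ofReal (g 0 z.2) +
      ENNReal.ofReal (a 1 z.1) * ENNReal.ofReal (g 1 z.2)) = _ := withDensity_add_left hm _
    rw [e1, ← hM2 0, ← hM2 1, ← Measure.map_add _ _ hP, ← withDensity_add_left (hS 0).ennreal_ofReal]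
    congr 1
    have : ((fun ω => ENNReal.ofReal (S 0 ω)) + fun ω => ENNReal.ofReal (S 1 ω)) = 1 := by
      funext ω
      simp only [Pi.add_apply, Pi.one_apply]
      rw [← ENNReal.ofReal_add (hS0 0 ω) (hS0 1 ω), hS1, ENNReal.ofReal_one]
    rw [this, withDensity_one]
  let R : E × ℝ → ℝ := fun z => (g 0 z.2 * a 0 z.1 + g 1 z.2 * a 1 z.1)⁻¹ * (g j z.2 * b z.1)
  have hRm : Measurable R := by
    have := ham 0; have := hg 0; have := ham 1; have := hg 1; have := hg j
    fun_prop
  have hq : ∀ᵐ z ∂κ, (0 ≤ a 0 z.1 ∧ 0 ≤ a 1 z.1 ∧ a 0 z.1 + a 1 z.1 = 1 ∧ 0 ≤ b z.1) := by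
    have hE : ∀ᵐ e ∂(μ.map W), (0 ≤ a 0 e ∧ 0 ≤ a 1 e ∧ a 0 e + a 1 e = 1 ∧ 0 ≤ b e) := by
      filter_upwards [ha0 0, ha0 1, ha1, hb0] with e h1 h2 h3 h4 using ⟨h1, h2, h3, h4⟩
    exact Measure.quasiMeasurePreserving_fst.ae hE
  have hpos : ∀ (u v : ℝ) (s : ℝ), 0 ≤ u → 0 ≤ v → u + v = 1 → 0 < g 0 s * u + g 1 s * v := by
    intro u v s hu hv huv
    have h0 := hg0 0 s
    have h1 := hg0 1 s
    rcases hu.eq_or_lt with h | h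
    · have : v = 1 := by linarith
      subst this; rw [← h]; simpa using h1
    · have := mul_pos h0 h
      have := mul_nonneg h1.le hv
      linarith
  have key : ∀ T, MeasurableSet T → ∫⁻ ω in P ⁻¹' T, ENNReal.ofReal (R (P ω)) ∂μ =
      ∫⁻ ω in P ⁻¹' T, ENNReal.ofReal (K ω) ∂μ := by
    intro T hT
    rw [← withDensity_apply (fun ω => ENNReal.ofReal (K ω)) (hP hT), ← Measure.map_apply hP hT, hM1, withDensity_apply _ hT,
      ← setLIntegral_map hT hRm.ennreal_ofReal hP, hlaw,
      setLIntegral_withDensity_eq_setLIntegral_mul _ _ hRm.ennreal_ofReal hT]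
    · apply lintegral_congr_ae
      apply ae_restrict_of_ae
      filter_upwards [hq] with z hz
      obtain ⟨z1, z2, z3, z4⟩ := hz
      have hp := hpos _ _ z.2 z1 z2 z3
      simp only [Pi.mul_apply, R]
      have g0 := (hg0 0 z.2).le
      have g1 := (hg0 1 z.2).le
      have gj := (hg0 j z.2).le
      rw [← ENNReal.ofReal_mul z1, ← ENNReal.ofReal_mul z2, ← ENNReal.ofReal_add (by positivity) (by positivity),
        ← ENNReal.ofReal_mul (by positivity), ← ENNReal.ofReal_mul z4]
      congr 1
      rw [mul_comm (a 0 z.1), mul_comm (a 1 z.1), ← mul_assoc, mul_inv_cancel₀ hp.ne']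
      ring
    · have := ham 0; have := hg 0; have := ham 1; have := hg 1
      fun_prop
  have hR0 : ∀ᵐ ω ∂μ, 0 ≤ R (P ω) := by
    filter_upwards [ae_of_ae_map hW.aemeasurable (ha0 0), ae_of_ae_map hW.aemeasurable (ha0 1),
      ae_of_ae_map hW.aemeasurable ha1, ae_of_ae_map hW.aemeasurable hb0] with ω w1 w2 w3 w4
    have hp := hpos _ _ (y ω) w1 w2 w3
    have gj := (hg0 j (y ω)).le
    simp only [R, P]
    positivity
  have hRP : Measurable (fun ω => R (P ω)) := hRm.comp hP
  have hRi : Integrable (fun ω => R (P ω)) μ := by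
    refine ⟨hRP.aestronglyMeasurable, ?_⟩
    rw [hasFiniteIntegral_iff_ofReal hR0]
    have := key Set.univ MeasurableSet.univ
    simp only [Set.preimage_univ, Measure.restrict_univ] at this
    rw [this, ← hasFiniteIntegral_iff_ofReal (ae_of_all _ hK0)]
    exact hK.2
  symm
  refine ae_eq_condExp_of_forall_setIntegral_eq hP.comap_le hK (fun s _ _ => hRi.integrableOn) ?_ ?_
  · rintro s ⟨T, hT, rfl⟩ _
    change ∫ ω in P ⁻¹' T, R (P ω) ∂μ = _
    rw [integral_eq_lintegral_of_nonneg_ae (ae_restrict_of_ae hR0) hRP.aestronglyMeasurable,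
      integral_eq_lintegral_of_nonneg_ae (ae_of_all _ hK0) hK.1.restrict, key T hT]
  · exact (hRm.comp (comap_measurable P)).aestronglyMeasurable

lemma occ_rect {Ω : Type*} (G F : MeasurableSpace Ω) {m0 : MeasurableSpace Ω} (μ : Measure Ω) [IsProbabilityMeasure μ]
    (hGF : G ≤ F) (hF : F ≤ m0) (y : Ω → ℝ) (hy : Measurable y)
    (S : Fin 2 → Ω → ℝ) (g : Fin 2 → ℝ → ℝ) (hg0 : ∀ i s, 0 < g i s)
    (hgi : ∀ i, Integrable (g i))
    (hem : ∀ T, MeasurableSet T →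
      μ[(y ⁻¹' T).indicator 1 | F] =ᵐ[μ] fun ω => ∑ i, S i ω * ∫ s in T, g i s)
    (K : Ω → ℝ) (hK : StronglyMeasurable[F] K) (hK0 : ∀ ω, 0 ≤ K ω) (C : ℝ) (hKC : ∀ ω, K ω ≤ C)
    (j : Fin 2) (hKS : ∀ i ω, K ω * S i ω = if i = j then K ω else 0)
    (D : Set Ω) (T : Set ℝ) (hD : MeasurableSet[G] D) (hT : MeasurableSet T) :
    ∫⁻ ω in D ∩ y ⁻¹' T, ENNReal.ofReal (K ω) ∂μ =
      (∫⁻ ω in D, ENNReal.ofReal ((μ[K | G]) ω) ∂μ) * ∫⁻ s in T, ENNReal.ofReal (g j s) := by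
  have hKi : Integrable K μ :=
    Integrable.of_bound (hK.mono hF).aestronglyMeasurable C
      (ae_of_all _ fun ω => by rw [Real.norm_eq_abs, abs_of_nonneg (hK0 ω)]; exact hKC ω)
  have hDm : MeasurableSet D := hF _ (hGF _ hD)
  have hTm : MeasurableSet (y ⁻¹' T) := hy hT
  have hc0 : 0 ≤ᵐ[μ] μ[K | G] := condExp_nonneg (ae_of_all _ hK0)
  rw [← ofReal_integral_eq_lintegral_ofReal hKi.integrableOn (ae_of_all _ hK0),
    ← ofReal_integral_eq_lintegral_ofReal integrable_condExp.integrableOn (ae_restrict_of_ae hc0),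
    ← ofReal_integral_eq_lintegral_ofReal (hgi j).integrableOn (ae_of_all _ fun s => (hg0 j s).le),
    setIntegral_condExp (hGF.trans hF) hKi hD,
    ← ENNReal.ofReal_mul (integral_nonneg hK0)]
  congr 1
  have hI : Integrable ((y ⁻¹' T).indicator (1 : Ω → ℝ)) μ :=
    (integrable_const (1 : ℝ)).indicator hTm
  have hpull := condExp_mul_of_stronglyMeasurable_left (μ := μ) (m := F) (f := K)
    (g := (y ⁻¹' T).indicator 1) hK
    (by
      have : K * (y ⁻¹' T).indicator 1 = (y ⁻¹' T).indicator K := by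
        funext ω; by_cases h : ω ∈ y ⁻¹' T <;> simp [h]
      rw [this]; exact hKi.indicator hTm) hI
  have hmul : K * (y ⁻¹' T).indicator 1 = (y ⁻¹' T).indicator K := by
    funext ω; by_cases h : ω ∈ y ⁻¹' T <;> simp [h]
  rw [hmul] at hpull
  calc ∫ ω in D ∩ y ⁻¹' T, K ω ∂μ = ∫ ω in D, (y ⁻¹' T).indicator K ω ∂μ := by
        rw [setIntegral_indicator hTm]
    _ = ∫ ω in D, (μ[(y ⁻¹' T).indicator K | F]) ω ∂μ :=
        (setIntegral_condExp hF (hKi.indicator hTm) (hGF _ hD)).symm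
    _ = ∫ ω in D, K ω * (∫ s in T, g j s) ∂μ := by
        apply integral_congr_ae
        apply ae_restrict_of_ae
        filter_upwards [hpull, hem T hT] with ω h1 h2
        rw [h1, Pi.mul_apply, h2, Finset.mul_sum]
        simp only [← mul_assoc, hKS]
        simp
    _ = _ := by rw [integral_mul_const]

lemma occ_step {Ω : Type*} (G F : MeasurableSpace Ω) {m0 : MeasurableSpace Ω} (μ : Measure Ω) [IsProbabilityMeasure μ]
    (hGF : G ≤ F) (hF : F ≤ m0) (y : Ω → ℝ) (hy : Measurable y)
    (S : Fin 2 → Ω → ℝ) (hS : ∀ i, StronglyMeasurable[F] (S i)) (hS0 : ∀ i ω, 0 ≤ S i ω)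
    (hS1 : ∀ ω, S 0 ω + S 1 ω = 1) (hSS : ∀ i j ω, S j ω * S i ω = if i = j then S j ω else 0)
    (f : Fin 2 → ℝ → ℝ) (hfpos : ∀ i s, 0 < f i s) (hfint : ∀ i, ∫ s, f i s = 1)
    (hem : ∀ (φ : ℝ → ℝ), Measurable φ → (∃ C, ∀ s, |φ s| ≤ C) →
      μ[fun ω => φ (y ω) | F] =ᵐ[μ] fun ω => ∑ i, S i ω * ∫ s, φ s * f i s)
    (H : Ω → ℝ) (hH : StronglyMeasurable[F] H) (hH0 : ∀ ω, 0 ≤ H ω) (C : ℝ) (hHC : ∀ ω, H ω ≤ C)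
    (j : Fin 2) :
    μ[fun ω => H ω * S j ω | G ⊔ MeasurableSpace.comap y inferInstance] =ᵐ[μ]
      fun ω => (f 0 (y ω) * (μ[S 0 | G]) ω + f 1 (y ω) * (μ[S 1 | G]) ω)⁻¹ *
        (f j (y ω) * (μ[fun ω => H ω * S j ω | G]) ω) := by
  have hGm : G ≤ m0 := hGF.trans hF
  have hfi : ∀ i, Integrable (f i) := fun i => by
    by_contra h
    have := hfint i
    rw [integral_undef h] at this
    exact zero_ne_one this
  have hex : ∀ i, ∃ g : ℝ → ℝ, Measurable g ∧ Set.range g ⊆ Set.Ioi 0 ∧ f i =ᵐ[volume] g := fun i =>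
    (hfi i).1.aemeasurable.exists_ae_eq_range_subset (ae_of_all _ fun s => hfpos i s) ⟨1, by simp⟩
  choose g hgm hgr hfg using hex
  have hg0 : ∀ i s, 0 < g i s := fun i s => hgr i ⟨s, rfl⟩
  have hgi : ∀ i, Integrable (g i) := fun i => (hfi i).congr (hfg i)
  have hem' : ∀ T, MeasurableSet T →
      μ[(y ⁻¹' T).indicator 1 | F] =ᵐ[μ] fun ω => ∑ i, S i ω * ∫ s in T, g i s := by
    intro T hT
    have := hem (T.indicator 1) (measurable_one.indicator hT) ⟨1, fun s => by
      by_cases h : s ∈ T <;> simp [h]⟩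
    have e1 : (fun ω => T.indicator (1 : ℝ → ℝ) (y ω)) = (y ⁻¹' T).indicator 1 := by
      funext ω; by_cases h : y ω ∈ T <;> simp [h]
    have e2 : ∀ i, ∫ s, T.indicator (1 : ℝ → ℝ) s * f i s = ∫ s in T, g i s := by
      intro i
      rw [← integral_indicator hT]
      apply integral_congr_ae
      filter_upwards [hfg i] with s hs
      by_cases h : s ∈ T <;> simp [h, hs]
    rw [e1] at this
    simpa only [e2] using this
  have hac : μ.map y ≪ volume := by
    refine Measure.AbsolutelyContinuous.mk fun T hT hT0 => ?_
    rw [Measure.map_apply hy hT]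
    have h1 : ∫ ω, (y ⁻¹' T).indicator (1 : Ω → ℝ) ω ∂μ = 0 := by
      rw [← integral_condExp hF, integral_congr_ae (hem' T hT)]
      simp [Measure.restrict_eq_zero.2 hT0]
    rw [integral_indicator_one (hy hT)] at h1
    exact (measureReal_eq_zero_iff).1 h1
  have hfgy : ∀ i, ∀ᵐ ω ∂μ, f i (y ω) = g i (y ω) := fun i =>
    ae_of_ae_map hy.aemeasurable (hac.ae_le (hfg i))
  have hSb : ∀ i ω, S i ω ≤ 1 := fun i ω => by
    have h0 := hS0 0 ω
    have h1 := hS0 1 ω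
    have h2 := hS1 ω
    fin_cases i <;> simp <;> linarith
  have hSi : ∀ i, Integrable (S i) μ := fun i =>
    Integrable.of_bound ((hS i).mono hF).aestronglyMeasurable 1
      (ae_of_all _ fun ω => by rw [Real.norm_eq_abs, abs_of_nonneg (hS0 i ω)]; exact hSb i ω)
  have hKm : StronglyMeasurable[F] (fun ω => H ω * S j ω) := hH.mul (hS j)
  have hK0 : ∀ ω, 0 ≤ H ω * S j ω := fun ω => mul_nonneg (hH0 ω) (hS0 j ω)
  have hKC : ∀ ω, H ω * S j ω ≤ C := fun ω =>
    (mul_le_of_le_one_right (hH0 ω) (hSb j ω)).trans (hHC ω)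
  have hKi : Integrable (fun ω => H ω * S j ω) μ :=
    Integrable.of_bound (hKm.mono hF).aestronglyMeasurable C
      (ae_of_all _ fun ω => by rw [Real.norm_eq_abs, abs_of_nonneg (hK0 ω)]; exact hKC ω)
  have hidm : @Measurable Ω Ω m0 G (fun ω => ω) := fun s hs => hGm s hs
  have hlint : ∀ (b : Ω → ℝ), Measurable[G] b → ∀ D, MeasurableSet[G] D →
      @lintegral Ω G ((@Measure.map Ω Ω m0 G (fun ω => ω) μ).restrict D) (fun e => ENNReal.ofReal (b e))
        = ∫⁻ ω in D, ENNReal.ofReal (b ω) ∂μ := by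
    intro b hb D hD
    exact @setLIntegral_map Ω Ω m0 G μ _ (fun ω => ω) D hD hb.ennreal_ofReal hidm
  have hae : ∀ (p : Ω → Prop), MeasurableSet[G] {ω | p ω} → (∀ᵐ ω ∂μ, p ω) →
      ∀ᵐ e ∂(@Measure.map Ω Ω m0 G (fun ω => ω) μ), p e := by
    intro p hp h
    exact (@ae_map_iff Ω Ω m0 G μ (fun ω => ω) (@Measurable.aemeasurable Ω Ω m0 G _ μ hidm) p hp).2 h
  have hcm : ∀ (k : Ω → ℝ), Measurable[G] (μ[k | G]) := fun k =>
    stronglyMeasurable_condExp.measurable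
  have hsum : ∀ᵐ ω ∂μ, (μ[S 0 | G]) ω + (μ[S 1 | G]) ω = 1 := by
    have h1 := condExp_add (hSi 0) (hSi 1) G
    have h2 : S 0 + S 1 = fun _ => (1 : ℝ) := funext hS1
    rw [h2, condExp_const hGm] at h1
    filter_upwards [h1] with ω h
    exact h.symm
  have main := @occ_bayes Ω Ω m0 G μ _ (fun ω => ω) y hidm hy (fun ω => H ω * S j ω) hKi hK0
    S (fun i => ((hS i).mono hF).measurable) hS0 hS1 g hgm hg0 (fun i => μ[S i | G])
    (fun i => hcm _)
    (fun i => hae _ (hcm _ measurableSet_Ici)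
      (condExp_nonneg (ae_of_all _ (hS0 i))))
    (hae _ (((hcm _).add (hcm _)) (measurableSet_singleton 1)) hsum)
    (μ[fun ω => H ω * S j ω | G]) (hcm _)
    (hae _ (hcm _ measurableSet_Ici)
      (condExp_nonneg (ae_of_all _ hK0))) j
    (by
      intro D T hD hT
      rw [hlint _ (hcm _) D hD]
      exact occ_rect G F μ hGF hF y hy S g hg0 hgi hem' _ hKm hK0 C hKC j
        (fun i ω => by rw [mul_assoc, hSS]; split_ifs <;> simp) D T hD hT)
    (by
      intro i D T hD hT
      rw [hlint _ (hcm _) D hD]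
      exact occ_rect G F μ hGF hF y hy S g hg0 hgi hem' _ (hS i) (hS0 i) 1 (hSb i) i
        (fun i' ω => hSS _ _ _) D T hD hT)
  have hcomap : @MeasurableSpace.comap Ω (Ω × ℝ) (fun ω => (ω, y ω))
      (@Prod.instMeasurableSpace Ω ℝ G _) = G ⊔ MeasurableSpace.comap y inferInstance := by
    unfold Prod.instMeasurableSpace MeasurableSpace.prod
    rw [MeasurableSpace.comap_sup, MeasurableSpace.comap_comp, MeasurableSpace.comap_comp]
    congr 1
    exact MeasurableSpace.comap_id
  rw [hcomap] at main
  filter_upwards [main, hfgy 0, hfgy 1, hfgy j] with ω h h0 h1 hj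
  rw [h, h0, h1, hj]

lemma occ_condExp_apply {Ω : Type*} (G : MeasurableSpace Ω) {m0 : MeasurableSpace Ω}
    (μ : Measure Ω) (Z : Ω → Fin 2 → ℝ) (hZ : Integrable Z μ) (j : Fin 2) :
    ∀ᵐ ω ∂μ, (μ[Z | G]) ω j = (μ[fun ω => Z ω j | G]) ω :=
  ContinuousLinearMap.comp_condExp_comm (m := G) hZ (ContinuousLinearMap.proj (R := ℝ) j)

lemma occ_drift {Ω : Type*} (G F : MeasurableSpace Ω) {m0 : MeasurableSpace Ω} (μ : Measure Ω)
    [IsProbabilityMeasure μ] (hGF : G ≤ F) (hF : F ≤ m0) (A : Matrix (Fin 2) (Fin 2) ℝ)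
    (X X' V : Ω → Fin 2 → ℝ) (hX : Integrable X μ) (hVi : Integrable V μ)
    (hdyn : ∀ ω, X' ω = A.mulVec (X ω) + V ω) (hV : μ[V | F] =ᵐ[μ] 0)
    (H : Ω → ℝ) (hH : StronglyMeasurable[F] H) (C : ℝ) (hHC : ∀ ω, ‖H ω‖ ≤ C) (j : Fin 2) :
    ∀ᵐ ω ∂μ, (μ[fun ω => H ω * X' ω j | G]) ω = A.mulVec ((μ[fun ω => H ω • X ω | G]) ω) j := by
  have hHX : Integrable (fun ω => H ω • X ω) μ :=
    hX.bdd_smul C (hH.mono hF).aestronglyMeasurable (ae_of_all _ hHC)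
  have hVj : Integrable (fun ω => V ω j) μ :=
    (ContinuousLinearMap.proj (R := ℝ) (φ := fun _ : Fin 2 => ℝ) j).integrable_comp hVi
  have hHV : Integrable (H * fun ω => V ω j) μ :=
    hVj.bdd_mul (c := C) (hH.mono hF).aestronglyMeasurable (ae_of_all _ hHC)
  let L : (Fin 2 → ℝ) →L[ℝ] ℝ :=
    LinearMap.toContinuousLinearMap ((LinearMap.proj j : (Fin 2 → ℝ) →ₗ[ℝ] ℝ) ∘ₗ A.mulVecLin)
  have hL : ∀ v, L v = A.mulVec v j := fun v => rfl
  have h1 := ContinuousLinearMap.comp_condExp_comm (m := G) hHX L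
  have h2 : μ[H * fun ω => V ω j | F] =ᵐ[μ] 0 := by
    filter_upwards [condExp_mul_of_stronglyMeasurable_left hH hHV hVj,
      occ_condExp_apply F μ V hVi j, hV] with ω a b c
    rw [a, Pi.mul_apply, ← b, c]
    simp
  have h3 : μ[H * fun ω => V ω j | G] =ᵐ[μ] 0 := by
    refine (condExp_condExp_of_le hGF hF).symm.trans ?_
    refine (condExp_congr_ae h2).trans ?_
    rw [condExp_zero]
  have h4 : (fun ω => H ω * X' ω j) = (L ∘ fun ω => H ω • X ω) + (H * fun ω => V ω j) := by
    funext ω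
    simp [hdyn, hL, Matrix.mulVec_smul, mul_add]
  rw [h4]
  filter_upwards [condExp_add (L.integrable_comp hHX) hHV G, h1, h3] with ω a b c
  have a' : (μ[(L ∘ fun ω => H ω • X ω) + (H * fun ω => V ω j) | G]) ω =
    (μ[(L ∘ fun ω => H ω • X ω) | G] + μ[H * fun ω => V ω j | G]) ω := a
  rw [a', Pi.add_apply, c, ← b]
  simp [hL]

/-- Occupation time filter recursion (Lemma 2). For the two-state
hidden Markov chain `X_k = A X_{k-1} + V_k` with observations `y_k` having
output likelihood matrix `B(y) = diag(f¹(y), f²(y))`, the conditional mean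
estimates `Ô_k^{i,X} = E[O_k^i X_k | y_{[1,k]}]` of the occupation times
`O_k^i = ∑_{n<k} ⟨X_n, e_i⟩` satisfy
`Ô_k^{i,X} = N_k B(y_k) A (Ô_{k-1}^{i,X} + X̂_{k-1}^i e_i)` where
`N_k⁻¹ = ⟨1, B(y_k) A X̂_{k-1}⟩` and `X̂_k = E[X_k | y_{[1,k]}]` is the HMM
filter state. -/
theorem occupation_time_filter_recursion
    {Ω : Type*} {m0 : MeasurableSpace Ω} (μ : Measure Ω) [IsProbabilityMeasure μ]
    (A : Matrix (Fin 2) (Fin 2) ℝ) (f : Fin 2 → ℝ → ℝ)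
    (X V : ℕ → Ω → (Fin 2 → ℝ)) (y : ℕ → Ω → ℝ)
    -- observation filtration 𝒢 k = σ(y₁, …, y_k) and full history ℱ k
    (𝒢 ℱ : ℕ → MeasurableSpace Ω)
    (h𝒢le : ∀ k, 𝒢 k ≤ m0) (hℱle : ∀ k, ℱ k ≤ m0)
    (h𝒢 : ∀ k, 𝒢 k =
      ⨆ i ∈ Finset.Icc 1 k, MeasurableSpace.comap (y i) inferInstance)
    (hℱ : ∀ k, ℱ k =
      (⨆ i ∈ Finset.range (k + 1), MeasurableSpace.comap (X i) inferInstance) ⊔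
      (⨆ i ∈ Finset.Icc 1 k, MeasurableSpace.comap (y i) inferInstance))
    -- the state is indicator-vector valued and follows the linear dynamics
    (hXval : ∀ k ω, X k ω = Pi.single 0 1 ∨ X k ω = Pi.single 1 1)
    (hdyn : ∀ k ω, X (k + 1) ω = A.mulVec (X k ω) + V (k + 1) ω)
    (hV : ∀ k, μ[V (k + 1) | ℱ k] =ᵐ[μ] 0)
    -- f¹, f² are probability densities and the observations are conditionally
    -- independent given the state, with density `f i` when `X_k = e_i`
    (hfpos : ∀ i s, 0 < f i s) (hfint : ∀ i, ∫ s, f i s = 1)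
    (hemission : ∀ k (φ : ℝ → ℝ), Measurable φ → (∃ C, ∀ s, |φ s| ≤ C) →
      μ[fun ω => φ (y (k + 1) ω) |
          (ℱ k ⊔ MeasurableSpace.comap (X (k + 1)) inferInstance)] =ᵐ[μ]
        fun ω => ∑ i, X (k + 1) ω i * ∫ s, φ s * f i s) :
    ∀ (i : Fin 2) (k : ℕ), 1 ≤ k →
      μ[fun ω => (∑ n ∈ Finset.range k, X n ω i) • X k ω | 𝒢 k] =ᵐ[μ]
        fun ω =>
          (∑ j, ((Matrix.diagonal fun i' => f i' (y k ω)).mulVec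
              (A.mulVec ((μ[X (k - 1) | 𝒢 (k - 1)]) ω))) j)⁻¹ •
          (Matrix.diagonal fun i' => f i' (y k ω)).mulVec
            (A.mulVec
              ((μ[fun ω' => (∑ n ∈ Finset.range (k - 1), X n ω' i) • X (k - 1) ω' |
                  𝒢 (k - 1)]) ω +
                ((μ[fun ω' => X (k - 1) ω' i | 𝒢 (k - 1)]) ω) •
                  (Pi.single i 1 : Fin 2 → ℝ))) := by
  intro i k hk
  obtain ⟨m, rfl⟩ : ∃ m, k = m + 1 := ⟨k - 1, by omega⟩
  simp only [Nat.add_sub_cancel]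
  -- basic facts on the state
  have hX01 : ∀ n j ω, X n ω j = 0 ∨ X n ω j = 1 := by
    intro n j ω
    rcases hXval n ω with h | h <;> rw [h] <;> fin_cases j <;> simp
  have hX0 : ∀ n j ω, 0 ≤ X n ω j := fun n j ω => by
    rcases hX01 n j ω with h | h <;> rw [h] <;> norm_num
  have hXle : ∀ n j ω, X n ω j ≤ 1 := fun n j ω => by
    rcases hX01 n j ω with h | h <;> rw [h] <;> norm_num
  have hX1 : ∀ n ω, X n ω 0 + X n ω 1 = 1 := by
    intro n ω
    rcases hXval n ω with h | h <;> rw [h] <;> simp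
  have hXX : ∀ n (a b : Fin 2) ω, X n ω b * X n ω a = if a = b then X n ω b else 0 := by
    intro n a b ω
    rcases hXval n ω with h | h <;> rw [h] <;> fin_cases a <;> fin_cases b <;> simp
  have hXℱ : ∀ m n, n ≤ m → Measurable[ℱ m] (X n) := by
    intro m n hn
    refine Measurable.mono (comap_measurable (X n)) ?_ le_rfl
    rw [hℱ m]
    refine le_sup_of_le_left ?_
    exact le_biSup (fun i => MeasurableSpace.comap (X i) inferInstance)
      (Finset.mem_range.2 (by omega) : n ∈ Finset.range (m + 1))
  have hXm : ∀ n, Measurable (X n) := fun n => (hXℱ n n le_rfl).mono (hℱle n) le_rfl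
  have hXi : ∀ n, Integrable (X n) μ := fun n =>
    Integrable.of_bound (hXm n).aestronglyMeasurable 1 (ae_of_all _ fun ω => by
      rw [pi_norm_le_iff_of_nonneg zero_le_one]
      intro j
      rw [Real.norm_eq_abs, abs_of_nonneg (hX0 n j ω)]
      exact hXle n j ω)
  have hy : Measurable (y (m + 1)) := by
    refine Measurable.mono (comap_measurable (y (m + 1))) (le_trans ?_ (h𝒢le (m + 1))) le_rfl
    rw [h𝒢]
    exact le_biSup (fun i => MeasurableSpace.comap (y i) inferInstance)
      (Finset.mem_Icc.2 ⟨by omega, le_rfl⟩ : m + 1 ∈ Finset.Icc 1 (m + 1))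
  have h𝒢ℱ : 𝒢 m ≤ ℱ m := by
    rw [h𝒢, hℱ]; exact le_sup_right
  have h𝒢succ : 𝒢 (m + 1) = 𝒢 m ⊔ MeasurableSpace.comap (y (m + 1)) inferInstance := by
    rw [h𝒢, h𝒢, ← Finset.insert_Icc_right_eq_Icc_add_one (by omega), Finset.iSup_insert, sup_comm]
  have hVi : Integrable (V (m + 1)) μ := by
    have : V (m + 1) = fun ω => X (m + 1) ω - A.mulVecLin.toContinuousLinearMap (X m ω) := by
      funext ω
      rw [hdyn m ω]
      exact (add_sub_cancel_left _ _).symm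
    rw [this]
    exact (hXi (m + 1)).sub (A.mulVecLin.toContinuousLinearMap.integrable_comp (hXi m))
  -- the occupation time
  let H : Ω → ℝ := fun ω => ∑ n ∈ Finset.range (m + 1), X n ω i
  have hHm : Measurable[ℱ m] H :=
    Finset.measurable_sum _ fun n hn =>
      (measurable_pi_apply i).comp (hXℱ m n (by have := Finset.mem_range.1 hn; omega))
  have hH0 : ∀ ω, 0 ≤ H ω := fun ω => Finset.sum_nonneg fun n _ => hX0 n i ω
  have hHC : ∀ ω, H ω ≤ (m + 1 : ℕ) := fun ω => by
    refine (Finset.sum_le_card_nsmul _ _ 1 fun n _ => hXle n i ω).trans ?_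
    simp
  have hHn : ∀ ω, ‖H ω‖ ≤ (m + 1 : ℕ) := fun ω => by
    rw [Real.norm_eq_abs, abs_of_nonneg (hH0 ω)]; exact hHC ω
  have hFm : ℱ m ⊔ MeasurableSpace.comap (X (m + 1)) inferInstance ≤ m0 :=
    sup_le (hℱle m) (hXm (m + 1)).comap_le
  have hHX : ∀ n, Integrable (fun ω => H ω • X n ω) μ := fun n =>
    (hXi n).bdd_smul _ (hHm.mono (hℱle m) le_rfl).aestronglyMeasurable (ae_of_all _ hHn)
  have hstep : ∀ j, _ := fun j => occ_step (𝒢 m)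
    (ℱ m ⊔ MeasurableSpace.comap (X (m + 1)) inferInstance) μ (h𝒢ℱ.trans le_sup_left) hFm
    (y (m + 1)) hy (fun j ω => X (m + 1) ω j)
    (fun j => ((measurable_pi_apply j).comp
      ((comap_measurable (X (m + 1))).mono (le_sup_right (a := ℱ m)) le_rfl)).stronglyMeasurable)
    (fun j ω => hX0 _ j ω) (hX1 _) (hXX _) f hfpos hfint (hemission m) H
    (hHm.stronglyMeasurable.mono le_sup_left) hH0 _ hHC j
  have hdr : ∀ j, _ := fun j => occ_drift (𝒢 m) (ℱ m) μ h𝒢ℱ (hℱle m) A (X m) (X (m + 1)) (V (m + 1))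
    (hXi m) hVi (hdyn m) (hV m) H hHm.stronglyMeasurable _ hHn j
  have hdr1 : ∀ j, _ := fun j => occ_drift (𝒢 m) (ℱ m) μ h𝒢ℱ (hℱle m) A (X m) (X (m + 1)) (V (m + 1))
    (hXi m) hVi (hdyn m) (hV m) (fun _ => 1) stronglyMeasurable_const 1 (by simp) j
  simp only [one_mul, one_smul] at hdr1
  -- splitting the occupation time
  have hOi : Integrable (fun ω => (∑ n ∈ Finset.range m, X n ω i) • X m ω) μ := by
    refine (hXi m).bdd_smul (φ := fun ω => ∑ n ∈ Finset.range m, X n ω i) (m : ℝ) ?_ (ae_of_all _ fun ω => ?_)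
    · exact (Finset.measurable_sum _ fun n _ =>
        (measurable_pi_apply i).comp (hXm n)).aestronglyMeasurable
    · rw [Real.norm_eq_abs, abs_of_nonneg (Finset.sum_nonneg fun n _ => hX0 n i ω)]
      refine (Finset.sum_le_card_nsmul _ _ 1 fun n _ => hXle n i ω).trans ?_
      simp
  have hXmi : Integrable (fun ω => X m ω i) μ :=
    (ContinuousLinearMap.proj (R := ℝ) (φ := fun _ : Fin 2 => ℝ) i).integrable_comp (hXi m)
  let L : ℝ →L[ℝ] (Fin 2 → ℝ) := ContinuousLinearMap.toSpanSingleton ℝ (Pi.single i 1)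
  have hsplit : (fun ω => H ω • X m ω) =
      (fun ω => (∑ n ∈ Finset.range m, X n ω i) • X m ω) + (L ∘ fun ω => X m ω i) := by
    funext ω
    simp only [H, Finset.sum_range_succ, add_smul, Pi.add_apply, Function.comp, L,
      ContinuousLinearMap.toSpanSingleton_apply]
    congr 1
    funext j
    simp only [Pi.smul_apply, smul_eq_mul, hXX, Pi.single_apply]
    split_ifs <;> simp
  have hZ : ∀ᵐ ω ∂μ, (μ[fun ω => H ω • X m ω | 𝒢 m]) ω =
      (μ[fun ω' => (∑ n ∈ Finset.range m, X n ω' i) • X m ω' | 𝒢 m]) ω +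
        ((μ[fun ω' => X m ω' i | 𝒢 m]) ω) • (Pi.single i 1 : Fin 2 → ℝ) := by
    rw [hsplit]
    filter_upwards [condExp_add hOi (L.integrable_comp hXmi) (𝒢 m),
      ContinuousLinearMap.comp_condExp_comm (m := 𝒢 m) hXmi L] with ω a b
    refine a.trans ?_
    rw [Pi.add_apply]
    congr 1
    exact b.symm
  rw [h𝒢succ]
  filter_upwards [ae_all_iff.2 hstep, ae_all_iff.2 hdr, ae_all_iff.2 hdr1, hZ,
    ae_all_iff.2 (occ_condExp_apply (𝒢 m ⊔ MeasurableSpace.comap (y (m + 1)) inferInstance) μ _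
      (hHX (m + 1)))] with ω s d d1 z c
  rw [← z]
  funext j
  refine (c j).trans ((s j).trans ?_)
  rw [d j, d1 0, d1 1]
  simp only [Pi.smul_apply, smul_eq_mul, Matrix.mulVec_diagonal, Fin.sum_univ_two]
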